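/- Let 0 < α < 1/4 and 0 < β < 1/4 be real numbers with β + 2α^{3/4} < 1/4, let p ≥ 2, and let n > 4/(1−4β). Suppose G_1,…,G_p are graphs on vertex set [n] that are 2-colored triangle free. If there exist indices 1 ≤ i < j ≤ p such that E(G_i) ∩ E(G_j) = ∅ and both e(G_i) > n²/4 − αn² and e(G_j) > n²/4 − αn², then Σ_{k=1}^{p} e(G_k) ≤ p·n²/4 − (p−2)βn². -/

import Mathlib

open Finset

/-- Graphs `G 1, …, G p` (edges of `G i` colored `i`) are 2-colored triangle free:
there are no vertices `x, y, z` and distinct colors `i ≠ j` with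
`xy, xz ∈ E(G i)` and `yz ∈ E(G j)`. -/
def TwoColoredTriangleFree {n p : ℕ} (G : Fin p → SimpleGraph (Fin n)) : Prop :=
  ¬ ∃ (i j : Fin p) (x y z : Fin n),
      i ≠ j ∧ (G i).Adj x y ∧ (G i).Adj x z ∧ (G j).Adj y z

open Classical in
/-- The number of neighbours of `v` in `S`. -/
noncomputable def degIn {V : Type*} (G : SimpleGraph V) (S : Finset V) (v : V) : ℕ :=
  #{u ∈ S | G.Adj v u}

section Counting

variable {V : Type*}

lemma degIn_union [DecidableEq V] (G : SimpleGraph V) {S T : Finset V} (h : Disjoint S T) (v : V) :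
    degIn G (S ∪ T) v = degIn G S v + degIn G T v := by
  classical
  unfold degIn
  rw [filter_union, card_union_of_disjoint (disjoint_filter_filter h)]

lemma sum_degIn_comm (G : SimpleGraph V) (S T : Finset V) :
    ∑ v ∈ S, degIn G T v = ∑ v ∈ T, degIn G S v := by
  classical
  simp only [degIn, card_filter]
  rw [sum_comm]
  simp only [G.adj_comm]

lemma sum_degIn_union [DecidableEq V] (G : SimpleGraph V) {S T : Finset V} (h : Disjoint S T) :
    ∑ v ∈ S ∪ T, degIn G (S ∪ T) v =
      ∑ v ∈ S, degIn G S v + 2 * ∑ v ∈ S, degIn G T v + ∑ v ∈ T, degIn G T v := by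
  rw [sum_union h]
  simp only [degIn_union G h, sum_add_distrib]
  rw [sum_degIn_comm G T S]
  ring

lemma degIn_sup {A B : SimpleGraph V} (hd : ∀ x y, A.Adj x y → ¬ B.Adj x y)
    (S : Finset V) (v : V) : degIn (A ⊔ B) S v = degIn A S v + degIn B S v := by
  classical
  unfold degIn
  rw [← card_union_of_disjoint (disjoint_filter.2 fun x _ h => hd v x h), ← filter_or]
  simp only [SimpleGraph.sup_adj]

lemma degIn_add_degIn_add_card_le {G G' : SimpleGraph V} {S X : Finset V} {u v : V} (hX : X ⊆ S)
    (hu : ∀ x ∈ X, ¬ G.Adj u x) (hv : ∀ x ∈ X, ¬ G'.Adj v x)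
    (huv : ∀ z ∈ S, G.Adj u z → ¬ G'.Adj v z) :
    degIn G S u + degIn G' S v + #X ≤ #S := by
  classical
  unfold degIn
  rw [← card_union_of_disjoint (disjoint_filter.2 huv), ← card_union_of_disjoint]
  · exact card_le_card (union_subset
      (union_subset (filter_subset _ _) (filter_subset _ _)) hX)
  · rw [disjoint_right]
    intro x hx h
    simp only [mem_union, mem_filter] at h
    rcases h with h | h
    exacts [hu x hx h.2, hv x hx h.2]

lemma degIn_le (G : SimpleGraph V) (S : Finset V) (v : V) : degIn G S v ≤ #S := by
  classical
  exact card_filter_le _ _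

lemma degIn_lt (G : SimpleGraph V) {S : Finset V} {v : V} (hv : v ∈ S) :
    degIn G S v + 1 ≤ #S := by
  classical
  exact card_lt_card (filter_ssubset.2 ⟨v, hv, G.irrefl⟩)

lemma degIn_eq_zero {G : SimpleGraph V} {S : Finset V} {v : V} (h : ∀ u ∈ S, ¬ G.Adj v u) :
    degIn G S v = 0 := by
  classical
  exact card_eq_zero.2 (filter_eq_empty_iff.2 fun u hu => h u hu)

lemma sum_degIn_self_add_card_le (G : SimpleGraph V) (S : Finset V) :
    ∑ v ∈ S, degIn G S v + #S ≤ #S * #S := by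
  calc ∑ v ∈ S, degIn G S v + #S = ∑ v ∈ S, (degIn G S v + 1) := by simp [sum_add_distrib]
    _ ≤ ∑ v ∈ S, #S := sum_le_sum fun v hv => degIn_lt G hv
    _ = #S * #S := by simp

lemma sum_degIn_univ [Fintype V] (G : SimpleGraph V) [DecidableRel G.Adj] :
    ∑ v, degIn G univ v = 2 * #G.edgeFinset := by
  rw [← G.sum_degrees_eq_twice_card_edges]
  refine sum_congr rfl fun v _ => ?_
  rw [← G.card_neighborFinset_eq_degree, G.neighborFinset_eq_filter, degIn]
  congr!

lemma sum_degIn_univ_compl [DecidableEq V] [Fintype V] (G : SimpleGraph V) (T : Finset V) :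
    ∑ v, degIn G univ v =
      ∑ v ∈ Tᶜ, degIn G Tᶜ v + 2 * ∑ v ∈ Tᶜ, degIn G T v + ∑ v ∈ T, degIn G T v := by
  rw [← sum_degIn_union G disjoint_compl_left, union_comm, union_compl]

/-- A set maximizing `3 ∑ deg - 2 |T| ^ 2` induces a graph of minimum degree about `2 |T| / 3`. -/
lemma exists_dense_min_degIn [DecidableEq V] [Fintype V] (G : SimpleGraph V) :
    ∃ T : Finset V, (∀ v ∈ T, 2 * #T ≤ 3 * degIn G T v + 1) ∧
      3 * ∑ v, degIn G univ v + 2 * (#T * #T) ≤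
        3 * ∑ v ∈ T, degIn G T v + 2 * (Fintype.card V * Fintype.card V) := by
  obtain ⟨T, -, hT⟩ := exists_max_image (univ : Finset (Finset V))
    (fun T => 3 * (∑ v ∈ T, degIn G T v : ℤ) - 2 * (#T * #T : ℤ)) ⟨∅, mem_univ _⟩
  refine ⟨T, fun v hv => ?_, ?_⟩
  · have h1 := hT (T.erase v) (mem_univ _)
    have h2 := sum_degIn_union G (disjoint_singleton_left.2 (notMem_erase v T))
    have hT' : {v} ∪ T.erase v = T := by rw [← insert_eq, insert_erase hv]
    have h3 := degIn_union G (disjoint_singleton_left.2 (notMem_erase v T)) v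
    have h4 : degIn G {v} v = 0 := degIn_eq_zero (by simp)
    have h5 : (#(T.erase v) : ℤ) = #T - 1 := by
      have := card_erase_add_one hv
      omega
    rw [hT', sum_singleton, sum_singleton] at h2
    rw [hT'] at h3
    have h2' : (∑ v ∈ T, degIn G T v : ℤ) =
        2 * degIn G T v + ∑ u ∈ T.erase v, degIn G (T.erase v) u := by
      rw [h3, h4]
      rw [h4] at h2
      push_cast
      exact_mod_cast (by omega)
    simp only [h5, h2'] at h1
    zify
    linarith
  · have := hT univ (mem_univ _)
    rw [card_univ] at this
    zify
    linarith

end Counting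

section TwoColors

variable {V : Type*} {A B : SimpleGraph V} {T : Finset V}

/-- The graphs `A`, `B` on `V` are edge disjoint, and all triangles of `A ⊔ B` are
contained in `A` or in `B`. -/
structure MonoTriangles (A B : SimpleGraph V) : Prop where
  disj : ∀ x y, A.Adj x y → ¬ B.Adj x y
  left : ∀ x y z, A.Adj x y → A.Adj x z → ¬ B.Adj y z
  right : ∀ x y z, B.Adj x y → B.Adj x z → ¬ A.Adj y z

lemma MonoTriangles.symm (h : MonoTriangles A B) : MonoTriangles B A :=
  ⟨fun x y hB hA => h.disj x y hA hB, h.right, h.left⟩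

lemma MonoTriangles.degIn_lt_of_adj [DecidableEq V] (h : MonoTriangles A B)
    (hT : ∀ v ∈ T, 2 * #T ≤ 3 * degIn (A ⊔ B) T v + 1) {u v : V} (hu : u ∈ T) (hv : v ∈ T)
    (huv : A.Adj u v) : degIn B T v < degIn A T v := by
  have h1 : degIn B T v + degIn (A ⊔ B) T u + #{u} ≤ #T := by
    refine degIn_add_degIn_add_card_le (by simpa using hu) ?_ (by simp) ?_
    · simpa using fun hb => h.disj _ _ huv.symm hb
    · rintro z - hvz (hz | hz)
      · exact h.left u v z huv hz hvz
      · exact h.right z u v hz.symm hvz.symm huv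
  have h2 := hT u hu
  have h3 := hT v hv
  have h4 := degIn_sup h.disj T v
  rw [card_singleton] at h1
  omega

lemma MonoTriangles.monochromatic [DecidableEq V] (h : MonoTriangles A B)
    (hT : ∀ v ∈ T, 2 * #T ≤ 3 * degIn (A ⊔ B) T v + 1) :
    (∀ u ∈ T, ∀ v ∈ T, ¬ A.Adj u v) ∨ (∀ u ∈ T, ∀ v ∈ T, ¬ B.Adj u v) := by
  by_contra! hcon
  obtain ⟨⟨u', hu', u, hu, hA⟩, ⟨v', hv', v, hv, hB⟩⟩ := hcon
  have hT' : ∀ v ∈ T, 2 * #T ≤ 3 * degIn (B ⊔ A) T v + 1 := by rwa [sup_comm]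
  have key : ∀ {x y z : V}, x ∈ T → y ∈ T → z ∈ T → A.Adj x y → ¬ B.Adj z y :=
    fun hx hy hz hxy hzy =>
      (h.degIn_lt_of_adj hT hx hy hxy).not_gt (h.symm.degIn_lt_of_adj hT' hz hy hzy)
  have hnadj : ¬ (A ⊔ B).Adj u v := by
    rintro (h' | h')
    · exact key hu hv hv' h' hB
    · exact key hu' hu hv hA h'.symm
  have hne : u ≠ v := by
    rintro rfl
    exact key hu' hu hv' hA hB
  have h1 : degIn (A ⊔ B) T u + degIn (A ⊔ B) T v + #{u, v} ≤ #T := by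
    refine degIn_add_degIn_add_card_le (by simp [insert_subset_iff, hu, hv]) ?_ ?_ ?_
    · simpa using hnadj
    · simpa [SimpleGraph.adj_comm] using hnadj
    · rintro z hz (h1 | h1) (h2 | h2)
      · exact key hz hv hv' h2.symm hB
      · exact key hu hz hv h1 h2
      · exact key hu' hu hz hA h1.symm
      · exact key hu' hu hz hA h1.symm
  have h2 := hT u hu
  have h3 := hT v hv
  rw [card_pair hne] at h1
  omega

/-- If a vertex `w` sends a `B`-edge to a dense `A`-monochromatic set `T`, then it has few
neighbours in `T`. -/
lemma MonoTriangles.three_mul_degIn_le [DecidableEq V] (h : MonoTriangles A B)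
    (hT : ∀ v ∈ T, 2 * #T ≤ 3 * degIn (A ⊔ B) T v + 1)
    (hmono : ∀ u ∈ T, ∀ v ∈ T, ¬ B.Adj u v) {w y : V} (hy : y ∈ T) (hwy : B.Adj w y) :
    3 * degIn (A ⊔ B) T w ≤ #T + 1 := by
  have h1 : degIn (A ⊔ B) T w + degIn (A ⊔ B) T y + #(∅ : Finset V) ≤ #T := by
    refine degIn_add_degIn_add_card_le (by simp) (by simp) (by simp) ?_
    rintro z hz hwz (hyz | hyz)
    · rcases hwz with hwz | hwz
      · exact h.left z w y hwz.symm hyz.symm hwy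
      · exact h.right w y z hwy hwz hyz
    · exact hmono y hy z hz hyz
  have h2 := hT y hy
  rw [card_empty] at h1
  omega

lemma MonoTriangles.false_of_monochromatic [DecidableEq V] [Fintype V] (h : MonoTriangles A B)
    (hT : ∀ v ∈ T, 2 * #T ≤ 3 * degIn (A ⊔ B) T v + 1)
    (hmono : ∀ u ∈ T, ∀ v ∈ T, ¬ B.Adj u v) (hcard : Fintype.card V < 2 * #T)
    (hAB : 3 * Fintype.card V ^ 2 < 4 * ∑ v, degIn (A ⊔ B) univ v)
    (hB : 3 * Fintype.card V ^ 2 < 8 * ∑ v, degIn B univ v) : False := by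
  classical
  set Q : Finset V := {w ∈ Tᶜ | ∃ y ∈ T, B.Adj w y}
  set R : Finset V := {w ∈ Tᶜ | ¬ ∃ y ∈ T, B.Adj w y}
  have hQR : #Q + #R = #Tᶜ := card_filter_add_card_filter_not _
  have hn : #T + #Tᶜ = Fintype.card V := card_add_card_compl T
  have hsplit (f : V → ℕ) : ∑ w ∈ Tᶜ, f w = ∑ w ∈ Q, f w + ∑ w ∈ R, f w :=
    (sum_filter_add_sum_filter_not _ _ _).symm
  have hdeg : ∀ w ∈ Q, 3 * degIn (A ⊔ B) T w ≤ #T + 1 := by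
    intro w hw
    obtain ⟨-, y, hy, hwy⟩ := mem_filter.1 hw
    exact h.three_mul_degIn_le hT hmono hy hwy
  have hQ1 : 3 * ∑ w ∈ Q, degIn (A ⊔ B) T w ≤ #Q * (#T + 1) := by
    rw [mul_sum, ← smul_eq_mul (#Q)]
    exact sum_le_card_nsmul _ _ _ hdeg
  have hQ2 : ∑ w ∈ Q, degIn B T w ≤ ∑ w ∈ Q, degIn (A ⊔ B) T w :=
    sum_le_sum fun w _ => by rw [degIn_sup h.disj]; omega
  have hR1 : ∑ w ∈ R, degIn (A ⊔ B) T w ≤ #R * #T := by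
    rw [← smul_eq_mul]
    exact sum_le_card_nsmul _ _ _ fun w _ => degIn_le _ _ _
  have hR2 : ∑ w ∈ R, degIn B T w = 0 := by
    refine sum_eq_zero fun w hw => degIn_eq_zero fun u hu hwu => ?_
    exact (mem_filter.1 hw).2 ⟨u, hu, hwu⟩
  have hB0 : ∑ v ∈ T, degIn B T v = 0 :=
    sum_eq_zero fun v hv => degIn_eq_zero (hmono v hv)
  rw [sum_degIn_univ_compl _ T, hsplit (degIn _ T)] at hAB hB
  have e1 := sum_degIn_self_add_card_le (A ⊔ B) T
  have e2 := sum_degIn_self_add_card_le (A ⊔ B) Tᶜ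
  have e3 := sum_degIn_self_add_card_le B Tᶜ
  rw [← hn] at hAB hB hcard
  rw [hB0, hR2] at hB
  have hlt : #Tᶜ + 1 ≤ #T := by omega
  have hX : 12 * (∑ w ∈ Q, degIn (A ⊔ B) T w) + 4 * (∑ w ∈ R, degIn (A ⊔ B) T w) ≤
      4 * (#Q * (#T + 1)) + 4 * (#R * #T) := by omega
  have hlin : 6 * (#T + #Tᶜ) ^ 2 + 12 * #Tᶜ + 4 * #T <
      12 * (#Tᶜ * #Tᶜ) + 4 * (#T * #T) + 8 * (#Q * (#T + 1)) + 8 * (#R * #T) := by omega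
  rw [← hQR] at hlin hlt
  generalize #T = m at hlin hlt
  generalize #Q = q at hlin hlt
  generalize #R = s at hlin hlt
  nlinarith [Nat.mul_le_mul_right (2 * m + 6 * (q + s)) hlt]

/-- Two edge disjoint graphs all of whose triangles are monochromatic cannot both have more than
`3 n ^ 2 / 16` edges. -/
lemma MonoTriangles.not_both_dense [DecidableEq V] [Fintype V]
    [DecidableRel A.Adj] [DecidableRel B.Adj] (h : MonoTriangles A B)
    (hA : 3 * Fintype.card V ^ 2 < 16 * #A.edgeFinset)
    (hB : 3 * Fintype.card V ^ 2 < 16 * #B.edgeFinset) : False := by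
  obtain ⟨T, hT, hsum⟩ := exists_dense_min_degIn (A ⊔ B)
  have hA' := sum_degIn_univ A
  have hB' := sum_degIn_univ B
  have hAB : ∑ v, degIn (A ⊔ B) univ v = ∑ v, degIn A univ v + ∑ v, degIn B univ v := by
    simp only [degIn_sup h.disj, sum_add_distrib]
  have hcard : Fintype.card V < 2 * #T := by
    have := sum_degIn_self_add_card_le (A ⊔ B) T
    by_contra! hle
    nlinarith
  rcases h.monochromatic hT with hm | hm
  · rw [sup_comm] at hT hAB
    exact h.symm.false_of_monochromatic hT hm hcard (by omega) (by omega)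
  · exact h.false_of_monochromatic hT hm hcard (by omega) (by omega)

end TwoColors

lemma lt_one_div_sixteen_of_rpow {α : ℝ} (h : α ^ ((3 : ℝ) / 4) < 1 / 8) : α < 1 / 16 := by
  by_contra! hle
  have h1 : (1 / 16 : ℝ) ^ ((3 : ℝ) / 4) ≤ α ^ ((3 : ℝ) / 4) :=
    Real.rpow_le_rpow (by norm_num) hle (by norm_num)
  have h2 : (1 / 16 : ℝ) ^ ((3 : ℝ) / 4) = 1 / 8 := by
    rw [show (1 / 16 : ℝ) = (1 / 2) ^ (4 : ℝ) by norm_num, ← Real.rpow_mul (by norm_num)]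
    norm_num
  linarith

theorem two_colored_mantel_disjoint (n p : ℕ) (α β : ℝ)
    (hα0 : 0 < α) (hα : α < 1 / 4) (hβ0 : 0 < β) (hβ : β < 1 / 4)
    (hαβ : β + 2 * α ^ ((3 : ℝ) / 4) < 1 / 4)
    (hp : 2 ≤ p) (hn : (n : ℝ) > 4 / (1 - 4 * β))
    (G : Fin p → SimpleGraph (Fin n)) [∀ i, DecidableRel (G i).Adj]
    (h : TwoColoredTriangleFree G)
    (i j : Fin p) (hij : i < j)
    (hdisj : Disjoint (G i).edgeFinset (G j).edgeFinset)
    (hi : ((G i).edgeFinset.card : ℝ) > (n : ℝ) ^ 2 / 4 - α * (n : ℝ) ^ 2)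
    (hj : ((G j).edgeFinset.card : ℝ) > (n : ℝ) ^ 2 / 4 - α * (n : ℝ) ^ 2) :
    ∑ k, ((G k).edgeFinset.card : ℝ) ≤
      (p : ℝ) * (n : ℝ) ^ 2 / 4 - ((p : ℝ) - 2) * β * (n : ℝ) ^ 2 := by
  exfalso
  have hα16 : α < 1 / 16 := lt_one_div_sixteen_of_rpow (by linarith)
  have hmono : MonoTriangles (G i) (G j) := by
    refine ⟨fun x y hx hy => ?_, fun x y z hy hz hyz => h ⟨i, j, x, y, z, hij.ne, hy, hz, hyz⟩,
      fun x y z hy hz hyz => h ⟨j, i, x, y, z, hij.ne', hy, hz, hyz⟩⟩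
    have hxA : s(x, y) ∈ (G i).edgeFinset := SimpleGraph.mem_edgeFinset.2 hx
    exact disjoint_left.1 hdisj hxA (SimpleGraph.mem_edgeFinset.2 hy)
  have key : ∀ e : ℕ, (e : ℝ) > (n : ℝ) ^ 2 / 4 - α * (n : ℝ) ^ 2 →
      3 * Fintype.card (Fin n) ^ 2 < 16 * e := by
    intro e he
    rw [Fintype.card_fin]
    have : (3 * n ^ 2 : ℝ) < 16 * e := by nlinarith [sq_nonneg (n : ℝ)]
    exact_mod_cast this
  exact hmono.not_both_dense (key _ hi) (key _ hj)
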